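/- arXiv:1710.08326 — 4 statements merged into one kernel-verified Lean document; each statement's English description precedes it below -/
import Mathlib

section
/- A formula A of the intuitionistic modal logic IK is a theorem of IK if and only if there exists a term t such that the sequent · ⊢ t : A is derivable in the Fitch-style calculus for IK (i.e., A is an inhabited type in the empty context). -/
namespace FitchIK

/-- Types (formulae) of intuitionistic modal logic IK. -/
inductive Ty : Type
  | base : Nat → Ty
  | unit : Ty
  | empty : Ty
  | prod : Ty → Ty → Ty
  | sum : Ty → Ty → Ty
  | arr : Ty → Ty → Ty
  | box : Ty → Ty

/-- A context entry is either a (de Bruijn) variable declaration or a lock 🔒. -/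
inductive Entry : Type
  | var : Ty → Entry
  | lock : Entry

/-- Contexts: lists of entries, with the *head* of the list the rightmost entry. -/
abbrev Ctx := List Entry

/-- The number of variable entries of a context. -/
def vars : Ctx → Nat
  | [] => 0
  | Entry.var _ :: Γ => vars Γ + 1
  | Entry.lock :: Γ => vars Γ

/-- A context is lock-free if it contains no lock. -/
def lockFree (Γ : Ctx) : Prop := Entry.lock ∉ Γ

/-- Terms, with de Bruijn indices counting variable entries.
In `scase k s t u` the recorded number `k` is the de Bruijn position of the
variable bound in the branches `t` and `u` (cf. the generalised sum elimination rule). -/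
inductive Tm : Type
  | var : Nat → Tm
  | lam : Tm → Tm
  | app : Tm → Tm → Tm
  | star : Tm
  | pair : Tm → Tm → Tm
  | fst : Tm → Tm
  | snd : Tm → Tm
  | inl : Tm → Tm
  | inr : Tm → Tm
  | scase : Nat → Tm → Tm → Tm → Tm
  | abort : Tm → Tm
  | shut : Tm → Tm
  | opn : Tm → Tm

/-- `t.lift d c` adds `d` to all variables of index `≥ c` (weakening). -/
def Tm.lift (d : Nat) : Tm → Nat → Tm
  | .var n, c => if n < c then .var n else .var (n + d)
  | .lam t, c => .lam (t.lift d (c+1))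
  | .app t u, c => .app (t.lift d c) (u.lift d c)
  | .star, _ => .star
  | .pair t u, c => .pair (t.lift d c) (u.lift d c)
  | .fst t, c => .fst (t.lift d c)
  | .snd t, c => .snd (t.lift d c)
  | .inl t, c => .inl (t.lift d c)
  | .inr t, c => .inr (t.lift d c)
  | .scase k s t u, c =>
      if c < k then .scase (k + d) (s.lift d c) (t.lift d c) (u.lift d c)
      else .scase k (s.lift d c) (t.lift d (c+1)) (u.lift d (c+1))
  | .abort t, c => .abort (t.lift d c)
  | .shut t, c => .shut (t.lift d c)
  | .opn t, c => .opn (t.lift d c)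

/-- `t.subst c u` is the capture-avoiding substitution `t[u/x]` of `u` for the
variable `x` of de Bruijn index `c` (variables above `c` are lowered by one). -/
def Tm.subst : Tm → Nat → Tm → Tm
  | .var n, c, u => if n < c then .var n else if n = c then u else .var (n - 1)
  | .lam t, c, u => .lam (t.subst (c+1) (u.lift 1 0))
  | .app t v, c, u => .app (t.subst c u) (v.subst c u)
  | .star, _, _ => .star
  | .pair t v, c, u => .pair (t.subst c u) (v.subst c u)
  | .fst t, c, u => .fst (t.subst c u)
  | .snd t, c, u => .snd (t.subst c u)
  | .inl t, c, u => .inl (t.subst c u)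
  | .inr t, c, u => .inr (t.subst c u)
  | .scase k s t v, c, u =>
      if c < k then .scase (k - 1) (s.subst c u) (t.subst c (u.lift 1 k)) (v.subst c (u.lift 1 k))
      else .scase k (s.subst c u) (t.subst (c+1) (u.lift 1 k)) (v.subst (c+1) (u.lift 1 k))
  | .abort t, c, u => .abort (t.subst c u)
  | .shut t, c, u => .shut (t.subst c u)
  | .opn t, c, u => .opn (t.subst c u)

/-- Variable lookup: the variable rule requires that no lock occurs to the
right of the variable used. -/
inductive Lookup : Ctx → Nat → Ty → Type
  | here {Γ : Ctx} {A : Ty} : Lookup (Entry.var A :: Γ) 0 A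
  | there {Γ : Ctx} {n : Nat} {A B : Ty} : Lookup Γ n A → Lookup (Entry.var B :: Γ) (n+1) A

/-- Typing derivations for the Fitch-style calculus for IK.  Sum eliminations
are the generalised ones (allowing an arbitrary context extension `Γ'`). -/
inductive Deriv : Ctx → Tm → Ty → Type
  | var {Γ n A} : Lookup Γ n A → Deriv Γ (.var n) A
  | lam {Γ t A B} : Deriv (Entry.var A :: Γ) t B → Deriv Γ (.lam t) (Ty.arr A B)
  | app {Γ t u A B} : Deriv Γ t (Ty.arr A B) → Deriv Γ u A → Deriv Γ (.app t u) B
  | star {Γ} : Deriv Γ .star Ty.unit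
  | pair {Γ t u A B} : Deriv Γ t A → Deriv Γ u B → Deriv Γ (.pair t u) (Ty.prod A B)
  | fst {Γ t A B} : Deriv Γ t (Ty.prod A B) → Deriv Γ (.fst t) A
  | snd {Γ t A B} : Deriv Γ t (Ty.prod A B) → Deriv Γ (.snd t) B
  | inl {Γ t A B} : Deriv Γ t A → Deriv Γ (.inl t) (Ty.sum A B)
  | inr {Γ t A B} : Deriv Γ t B → Deriv Γ (.inr t) (Ty.sum A B)
  | scase {Γ s t u A B C} : Deriv Γ s (Ty.sum A B) → (Γ' : Ctx) →
      Deriv (Γ' ++ Entry.var A :: Γ) t C → Deriv (Γ' ++ Entry.var B :: Γ) u C →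
      Deriv (Γ' ++ Γ) (.scase (vars Γ') (s.lift (vars Γ') 0) t u) C
  | abort {Γ t A} : Deriv Γ t Ty.empty → (Γ' : Ctx) →
      Deriv (Γ' ++ Γ) (.abort (t.lift (vars Γ') 0)) A
  | shut {Γ t A} : Deriv (Entry.lock :: Γ) t A → Deriv Γ (.shut t) (Ty.box A)
  | opn {Γ t A} : Deriv Γ t (Ty.box A) → (Γ' : Ctx) → lockFree Γ' →
      Deriv (Γ' ++ Entry.lock :: Γ) (.opn (t.lift (vars Γ') 0)) A

/-- One-step reduction: compatible closure of β-reduction, `open (shut t) ↦ t`,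
and the commuting conversions for sums. -/
inductive Step : Tm → Tm → Prop
  | beta {t u} : Step (.app (.lam t) u) (t.subst 0 u)
  | betaFst {t u} : Step (.fst (.pair t u)) t
  | betaSnd {t u} : Step (.snd (.pair t u)) u
  | betaInl {k a t u} : Step (.scase k (.inl a) t u) (t.subst k a)
  | betaInr {k a t u} : Step (.scase k (.inr a) t u) (u.subst k a)
  | betaOpenShut {t} : Step (.opn (.shut t)) t
  | commCase {k s t u} : Step (.opn (.scase k s t u)) (.scase k s (.opn t) (.opn u))
  | commAbort {t} : Step (.opn (.abort t)) (.abort t)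
  | lam {t t'} : Step t t' → Step (.lam t) (.lam t')
  | app₁ {t t' u} : Step t t' → Step (.app t u) (.app t' u)
  | app₂ {t u u'} : Step u u' → Step (.app t u) (.app t u')
  | pair₁ {t t' u} : Step t t' → Step (.pair t u) (.pair t' u)
  | pair₂ {t u u'} : Step u u' → Step (.pair t u) (.pair t u')
  | fst {t t'} : Step t t' → Step (.fst t) (.fst t')
  | snd {t t'} : Step t t' → Step (.snd t) (.snd t')
  | inl {t t'} : Step t t' → Step (.inl t) (.inl t')
  | inr {t t'} : Step t t' → Step (.inr t) (.inr t')
  | scase₀ {k s s' t u} : Step s s' → Step (.scase k s t u) (.scase k s' t u)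
  | scase₁ {k s t t' u} : Step t t' → Step (.scase k s t u) (.scase k s t' u)
  | scase₂ {k s t u u'} : Step u u' → Step (.scase k s t u) (.scase k s t u')
  | abort {t t'} : Step t t' → Step (.abort t) (.abort t')
  | shut {t t'} : Step t t' → Step (.shut t) (.shut t')
  | opn {t t'} : Step t t' → Step (.opn t) (.opn t')

end FitchIK

namespace FitchIK

/-- Hilbert-style provability for the intuitionistic modal logic IK:
intuitionistic propositional logic plus the K axiom and the necessitation rule. -/
inductive Thm : Ty → Prop
  | mp {A B} : Thm (Ty.arr A B) → Thm A → Thm B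
  | nec {A} : Thm A → Thm (Ty.box A)
  | imp₁ {A B} : Thm (Ty.arr A (Ty.arr B A))
  | imp₂ {A B C} : Thm (Ty.arr (Ty.arr A (Ty.arr B C))
      (Ty.arr (Ty.arr A B) (Ty.arr A C)))
  | truth : Thm Ty.unit
  | exfalso {A} : Thm (Ty.arr Ty.empty A)
  | pairIntro {A B} : Thm (Ty.arr A (Ty.arr B (Ty.prod A B)))
  | prodElim₁ {A B} : Thm (Ty.arr (Ty.prod A B) A)
  | prodElim₂ {A B} : Thm (Ty.arr (Ty.prod A B) B)
  | sumIntro₁ {A B} : Thm (Ty.arr A (Ty.sum A B))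
  | sumIntro₂ {A B} : Thm (Ty.arr B (Ty.sum A B))
  | sumElim {A B C} : Thm (Ty.arr (Ty.arr A C)
      (Ty.arr (Ty.arr B C) (Ty.arr (Ty.sum A B) C)))
  | axK {A B} : Thm (Ty.arr (Ty.box (Ty.arr A B)) (Ty.arr (Ty.box A) (Ty.box B)))

/-- The formula expressing the sequent `Γ ⊢ A`: variables become antecedents of implications
and locks become boxes. -/
def seqTy : Ctx → Ty → Ty
  | [], A => A
  | Entry.var B :: Γ, A => seqTy Γ (Ty.arr B A)
  | Entry.lock :: Γ, A => seqTy Γ (Ty.box A)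

theorem seqTy_append (Γ' Γ : Ctx) (A : Ty) : seqTy (Γ' ++ Γ) A = seqTy Γ (seqTy Γ' A) := by
  induction Γ' generalizing A with
  | nil => rfl
  | cons e Γ' ih => cases e <;> exact ih _

namespace Thm

theorem id (A : Ty) : Thm (Ty.arr A A) :=
  mp (mp imp₂ imp₁) (imp₁ (B := A))

theorem const {A : Ty} (B : Ty) (h : Thm A) : Thm (Ty.arr B A) := mp imp₁ h

theorem ap {A B C : Ty} (f : Thm (Ty.arr A (Ty.arr B C))) (x : Thm (Ty.arr A B)) :
    Thm (Ty.arr A C) := mp (mp imp₂ f) x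

theorem comp {A B C : Ty} (f : Thm (Ty.arr A B)) (g : Thm (Ty.arr B C)) : Thm (Ty.arr A C) :=
  ap (const A g) f

theorem seqTy_pure (Γ : Ctx) {A : Ty} (h : Thm A) : Thm (seqTy Γ A) := by
  induction Γ generalizing A with
  | nil => exact h
  | cons e Γ ih =>
    cases e with
    | var B => exact ih (const B h)
    | lock => exact ih (nec h)

/-- Modus ponens is admissible under the hypotheses and locks of any context. -/
theorem seqTy_mp (Γ : Ctx) {A B : Ty} (f : Thm (seqTy Γ (Ty.arr A B))) (x : Thm (seqTy Γ A)) :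
    Thm (seqTy Γ B) := by
  induction Γ generalizing A B with
  | nil => exact mp f x
  | cons e Γ ih =>
    cases e with
    | var C => exact ih (ih (seqTy_pure Γ imp₂) f) x
    | lock => exact ih (ih (seqTy_pure Γ axK) f) x

theorem seqTy_map (Γ : Ctx) {A B : Ty} (f : Thm (Ty.arr A B)) (x : Thm (seqTy Γ A)) :
    Thm (seqTy Γ B) := seqTy_mp Γ (seqTy_pure Γ f) x

theorem seqTy_map₂ (Γ : Ctx) {A B C : Ty} (f : Thm (Ty.arr A (Ty.arr B C)))
    (x : Thm (seqTy Γ A)) (y : Thm (seqTy Γ B)) : Thm (seqTy Γ C) :=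
  seqTy_mp Γ (seqTy_map Γ f x) y

theorem arr_seqTy_of_lockFree {Γ : Ctx} (h : lockFree Γ) (A : Ty) :
    Thm (Ty.arr A (seqTy Γ A)) := by
  induction Γ generalizing A with
  | nil => exact id A
  | cons e Γ ih =>
    cases e with
    | var B => exact comp imp₁ (ih (fun hm => h (List.mem_cons_of_mem _ hm)) (Ty.arr B A))
    | lock => exact absurd List.mem_cons_self h

theorem box_mono {A B : Ty} (h : Thm (Ty.arr A B)) : Thm (Ty.arr (Ty.box A) (Ty.box B)) :=
  mp axK (nec h)

end Thm

theorem Lookup.thm {Γ : Ctx} {n : Nat} {A : Ty} (l : Lookup Γ n A) : Thm (seqTy Γ A) := by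
  induction l with
  | @here Γ A => exact Thm.seqTy_pure Γ (Thm.id A)
  | @there Γ _ _ _ _ ih => exact Thm.seqTy_map Γ Thm.imp₁ ih

/-- Derivable sequents are theorems of IK. -/
theorem Deriv.thm {Γ : Ctx} {t : Tm} {A : Ty} (d : Deriv Γ t A) : Thm (seqTy Γ A) := by
  induction d with
  | var l => exact l.thm
  | lam _ ih => exact ih
  | app _ _ ih₁ ih₂ => exact Thm.seqTy_mp _ ih₁ ih₂
  | star => exact Thm.seqTy_pure _ Thm.truth
  | pair _ _ ih₁ ih₂ => exact Thm.seqTy_map₂ _ Thm.pairIntro ih₁ ih₂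
  | fst _ ih => exact Thm.seqTy_map _ Thm.prodElim₁ ih
  | snd _ ih => exact Thm.seqTy_map _ Thm.prodElim₂ ih
  | inl _ ih => exact Thm.seqTy_map _ Thm.sumIntro₁ ih
  | inr _ ih => exact Thm.seqTy_map _ Thm.sumIntro₂ ih
  | scase _ Γ' _ _ ih₀ ih₁ ih₂ =>
    rw [seqTy_append] at ih₁ ih₂ ⊢
    exact Thm.seqTy_mp _ (Thm.seqTy_map₂ _ Thm.sumElim ih₁ ih₂) ih₀
  | abort _ Γ' ih =>
    rw [seqTy_append]
    exact Thm.seqTy_map _ Thm.exfalso ih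
  | shut _ ih => exact ih
  | @opn Γ _ _ _ Γ' h ih =>
    rw [seqTy_append]
    exact Thm.seqTy_map Γ (Thm.box_mono (Thm.arr_seqTy_of_lockFree h _)) ih

theorem Lookup.append {Γ : Ctx} {n : Nat} {A : Ty} (l : Lookup Γ n A) (Δ : Ctx) :
    Nonempty (Lookup (Γ ++ Δ) n A) := by
  induction l with
  | here => exact ⟨.here⟩
  | there _ ih => exact ih.map .there

/-- Extending the context on the left changes neither derivability nor the term. -/
theorem Deriv.append {Γ : Ctx} {t : Tm} {A : Ty} (d : Deriv Γ t A) (Δ : Ctx) :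
    Nonempty (Deriv (Γ ++ Δ) t A) := by
  induction d with
  | var l => exact (l.append Δ).map .var
  | lam _ ih => exact ih.map .lam
  | app _ _ ih₁ ih₂ => exact ih₁.elim fun d₁ => ih₂.map d₁.app
  | star => exact ⟨.star⟩
  | pair _ _ ih₁ ih₂ => exact ih₁.elim fun d₁ => ih₂.map d₁.pair
  | fst _ ih => exact ih.map .fst
  | snd _ ih => exact ih.map .snd
  | inl _ ih => exact ih.map .inl
  | inr _ ih => exact ih.map .inr
  | scase _ Γ' _ _ ih₀ ih₁ ih₂ =>
    rw [List.append_assoc] at ih₁ ih₂ ⊢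
    obtain ⟨d₀⟩ := ih₀
    obtain ⟨d₁⟩ := ih₁
    obtain ⟨d₂⟩ := ih₂
    exact ⟨.scase d₀ Γ' d₁ d₂⟩
  | abort _ Γ' ih =>
    rw [List.append_assoc]
    exact ih.map (.abort · Γ')
  | shut _ ih => exact ih.map .shut
  | opn _ Γ' h ih =>
    rw [List.append_assoc]
    exact ih.map (.opn · Γ' h)

/-- Theorems of IK are inhabited in the empty context. -/
theorem Thm.exists_deriv {A : Ty} (h : Thm A) : ∃ t : Tm, Nonempty (Deriv [] t A) := by
  induction h with
  | mp _ _ ih₁ ih₂ =>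
    obtain ⟨t, ⟨d⟩⟩ := ih₁
    obtain ⟨u, ⟨e⟩⟩ := ih₂
    exact ⟨_, ⟨d.app e⟩⟩
  | nec _ ih =>
    obtain ⟨t, ⟨d⟩⟩ := ih
    exact ⟨_, (d.append [Entry.lock]).map .shut⟩
  | imp₁ => exact ⟨_, ⟨.lam (.lam (.var (.there .here)))⟩⟩
  | imp₂ =>
    exact ⟨_, ⟨.lam (.lam (.lam (.app (.app (.var (.there (.there .here))) (.var .here))
      (.app (.var (.there .here)) (.var .here)))))⟩⟩
  | truth => exact ⟨_, ⟨.star⟩⟩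
  | exfalso => exact ⟨_, ⟨.lam (.abort (.var .here) [])⟩⟩
  | pairIntro => exact ⟨_, ⟨.lam (.lam (.pair (.var (.there .here)) (.var .here)))⟩⟩
  | prodElim₁ => exact ⟨_, ⟨.lam (.fst (.var .here))⟩⟩
  | prodElim₂ => exact ⟨_, ⟨.lam (.snd (.var .here))⟩⟩
  | sumIntro₁ => exact ⟨_, ⟨.lam (.inl (.var .here))⟩⟩
  | sumIntro₂ => exact ⟨_, ⟨.lam (.inr (.var .here))⟩⟩
  | sumElim =>
    exact ⟨_, ⟨.lam (.lam (.lam (.scase (.var .here) []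
      (.app (.var (.there (.there (.there .here)))) (.var .here))
      (.app (.var (.there (.there .here))) (.var .here)))))⟩⟩
  | axK =>
    have hnil : lockFree [] := List.not_mem_nil
    exact ⟨_, ⟨.lam (.lam (.shut (.app (.opn (.var (.there .here)) [] hnil)
      (.opn (.var .here) [] hnil))))⟩⟩

/-- Logical soundness and completeness:
a formula `A` is a theorem of IK if and only if it is an inhabited type in the
empty context of the Fitch-style calculus for IK. -/
theorem logical_soundness_and_completeness (A : Ty) :
    Thm A ↔ ∃ t : Tm, Nonempty (Deriv [] t A) :=
  ⟨Thm.exists_deriv, fun ⟨_, ⟨d⟩⟩ => d.thm⟩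

end FitchIK
end

section
/- Canonicity for the Fitch-style IK calculus: if Γ is a context containing no variable assignments (i.e., consisting only of locks), Γ ⊢ t : A is derivable, and t is normal (ν(t) = 0, i.e., t admits no reduction step), then the main term-former of t is the introduction form for the main type-former of A. -/
namespace FitchIK

/-- `t` is normal when it admits no reduction step. -/
def Normal (t : Tm) : Prop := ∀ u, ¬ Step t u

/-- `MainIntro t A` holds when the main term-former of `t` is the introduction
form for the main type-former of `A`. -/
def MainIntro : Tm → Ty → Prop
  | Tm.star, Ty.unit => True
  | Tm.pair _ _, Ty.prod _ _ => True
  | Tm.inl _, Ty.sum _ _ => True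
  | Tm.inr _, Ty.sum _ _ => True
  | Tm.lam _, Ty.arr _ _ => True
  | Tm.shut _, Ty.box _ => True
  | _, _ => False

theorem Tm.lift_zero (t : Tm) : ∀ c, t.lift 0 c = t := by
  induction t <;> intro c <;> simp_all [Tm.lift]

theorem vars_eq_zero {Γ : Ctx} (h : ∀ e ∈ Γ, e = Entry.lock) : vars Γ = 0 := by
  induction Γ with
  | nil => rfl
  | cons e Γ ih =>
    obtain rfl := h e (by simp)
    exact ih fun e' he' => h e' (by simp [he'])

theorem Tm.lift_vars_eq_self {Γ' Γ : Ctx} (h : ∀ e ∈ Γ' ++ Γ, e = Entry.lock) (t : Tm) (c : Nat) :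
    t.lift (vars Γ') c = t := by
  rw [vars_eq_zero fun e he => h e (List.mem_append_left _ he), Tm.lift_zero]

theorem MainIntro.eq_lam {t : Tm} {A B : Ty} (h : MainIntro t (Ty.arr A B)) :
    ∃ b, t = .lam b := by
  cases t <;> simp_all [MainIntro]

theorem MainIntro.eq_pair {t : Tm} {A B : Ty} (h : MainIntro t (Ty.prod A B)) :
    ∃ a b, t = .pair a b := by
  cases t <;> simp_all [MainIntro]

theorem MainIntro.eq_inl_or_inr {t : Tm} {A B : Ty} (h : MainIntro t (Ty.sum A B)) :
    (∃ a, t = .inl a) ∨ ∃ b, t = .inr b := by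
  cases t <;> simp_all [MainIntro]

theorem MainIntro.eq_shut {t : Tm} {A : Ty} (h : MainIntro t (Ty.box A)) :
    ∃ b, t = .shut b := by
  cases t <;> simp_all [MainIntro]

theorem not_mainIntro_empty (t : Tm) : ¬ MainIntro t Ty.empty := by
  cases t <;> simp [MainIntro]

/-- Canonicity: if `Γ` contains no variable assignments
(it consists only of locks), `Γ ⊢ t : A` is derivable, and `t` is normal,
then the main term-former of `t` is the introduction form for the main
type-former of `A`. -/
theorem canonicity {Γ : Ctx} {t : Tm} {A : Ty}
    (hΓ : ∀ e ∈ Γ, e = Entry.lock) (d : Deriv Γ t A) (hn : Normal t) :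
    MainIntro t A := by
  induction d with
  | var l => cases l <;> simpa using hΓ _ List.mem_cons_self
  | lam | star | pair | inl | inr | shut => trivial
  | app _ _ ih _ =>
    obtain ⟨b, rfl⟩ := (ih hΓ fun _ h => hn _ (.app₁ h)).eq_lam
    exact (hn _ .beta).elim
  | fst _ ih =>
    obtain ⟨a, b, rfl⟩ := (ih hΓ fun _ h => hn _ (.fst h)).eq_pair
    exact (hn _ .betaFst).elim
  | snd _ ih =>
    obtain ⟨a, b, rfl⟩ := (ih hΓ fun _ h => hn _ (.snd h)).eq_pair
    exact (hn _ .betaSnd).elim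
  | scase _ Γ' _ _ ih _ _ =>
    rw [Tm.lift_vars_eq_self hΓ] at hn
    obtain ⟨a, rfl⟩ | ⟨b, rfl⟩ := (ih (fun e he => hΓ e (List.mem_append_right _ he))
      fun _ h => hn _ (.scase₀ h)).eq_inl_or_inr
    · exact (hn _ .betaInl).elim
    · exact (hn _ .betaInr).elim
  | abort _ Γ' ih =>
    rw [Tm.lift_vars_eq_self hΓ] at hn
    exact (not_mainIntro_empty _ (ih (fun e he => hΓ e (List.mem_append_right _ he))
      fun _ h => hn _ (.abort h))).elim
  | opn _ Γ' _ ih =>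
    rw [Tm.lift_vars_eq_self hΓ] at hn
    obtain ⟨b, rfl⟩ := (ih (fun e he => hΓ e (by simp [he])) fun _ h => hn _ (.opn h)).eq_shut
    exact (hn _ .betaOpenShut).elim

end FitchIK
end

section
/- Lock Replacement for the Fitch-style IS4 calculus: if Γ, 🔒, Γ'' ⊢ t : A is derivable then Γ, Γ', Γ'' ⊢ t : A is derivable, for any context Γ'. -/
namespace FitchIS4

/-- Types of the Fitch-style calculus for IS4. -/
inductive Ty : Type
  | base : Nat → Ty
  | arr : Ty → Ty → Ty
  | box : Ty → Ty

/-- A context entry is either a variable declaration or a lock 🔒. -/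
inductive Entry : Type
  | var : Ty → Entry
  | lock : Entry

/-- Contexts: lists of entries, the head of the list being the rightmost entry. -/
abbrev Ctx := List Entry

/-- The number of variable entries of a context. -/
def vars : Ctx → Nat
  | [] => 0
  | Entry.var _ :: Γ => vars Γ + 1
  | Entry.lock :: Γ => vars Γ

/-- Terms, with de Bruijn indices counting variable entries. -/
inductive Tm : Type
  | var : Nat → Tm
  | lam : Tm → Tm
  | app : Tm → Tm → Tm
  | shut : Tm → Tm
  | opn : Tm → Tm

/-- `t.lift d c` adds `d` to the variables of index `≥ c` (weakening). -/
def Tm.lift (d : Nat) : Tm → Nat → Tm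
  | .var n, c => if n < c then .var n else .var (n + d)
  | .lam t, c => .lam (t.lift d (c+1))
  | .app t u, c => .app (t.lift d c) (u.lift d c)
  | .shut t, c => .shut (t.lift d c)
  | .opn t, c => .opn (t.lift d c)

/-- Variable lookup (no lock may occur to the right of the variable). -/
inductive Lookup : Ctx → Nat → Ty → Type
  | here {Γ A} : Lookup (Entry.var A :: Γ) 0 A
  | there {Γ n A B} : Lookup Γ n A → Lookup (Entry.var B :: Γ) (n+1) A

/-- Typing derivations for the Fitch-style calculus for IS4: the IK rules for
variables, `λ`, application and `shut`, with the □-elimination rule: from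
`Γ ⊢ t : □A` conclude `Γ, Γ' ⊢ open t : A` for an arbitrary extension `Γ'`. -/
inductive Deriv : Ctx → Tm → Ty → Type
  | var {Γ n A} : Lookup Γ n A → Deriv Γ (.var n) A
  | lam {Γ t A B} : Deriv (Entry.var A :: Γ) t B → Deriv Γ (.lam t) (Ty.arr A B)
  | app {Γ t u A B} : Deriv Γ t (Ty.arr A B) → Deriv Γ u A → Deriv Γ (.app t u) B
  | shut {Γ t A} : Deriv (Entry.lock :: Γ) t A → Deriv Γ (.shut t) (Ty.box A)
  | opn {Γ t A} : Deriv Γ t (Ty.box A) → (Γ' : Ctx) →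
      Deriv (Γ' ++ Γ) (.opn (t.lift (vars Γ') 0)) A

end FitchIS4

namespace FitchIS4

theorem vars_append (Γ Δ : Ctx) : vars (Γ ++ Δ) = vars Γ + vars Δ := by
  induction Γ with
  | nil => simp [vars]
  | cons x Γ ih => cases x <;> simp [vars, ih]; omega

/-- Lifting at a position inside an already inserted block enlarges that block. -/
theorem Tm.lift_lift_of_le (t : Tm) {a b c k : Nat} (hk : k ≤ a) :
    (t.lift a c).lift b (c + k) = t.lift (a + b) c := by
  induction t generalizing c with
  | var n => simp only [Tm.lift]; split_ifs <;> simp only [Tm.lift] <;> grind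
  | lam t ih => simp only [Tm.lift, ← ih (c := c + 1), Nat.add_right_comm c k 1]
  | app t u iht ihu => simp only [Tm.lift, iht, ihu]
  | shut t ih => simp only [Tm.lift, ih]
  | opn t ih => simp only [Tm.lift, ih]

/-- Lifting beyond an inserted block commutes with the insertion of that block. -/
theorem Tm.lift_lift_comm (t : Tm) (a b c r : Nat) :
    (t.lift a c).lift b (c + (a + r)) = (t.lift b (c + r)).lift a c := by
  induction t generalizing c with
  | var n => simp only [Tm.lift]; split_ifs <;> simp only [Tm.lift] <;> grind
  | lam t ih =>
    have := ih (c + 1)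
    simp only [Nat.add_right_comm c 1] at this
    simp only [Tm.lift, this]
  | app t u iht ihu => simp only [Tm.lift, iht, ihu]
  | shut t ih => simp only [Tm.lift, ih]
  | opn t ih => simp only [Tm.lift, ih]

def Lookup.append_right {Γ : Ctx} {n : Nat} {A : Ty} (Δ : Ctx) :
    Lookup Γ n A → Lookup (Γ ++ Δ) n A
  | .here => .here
  | .there l => .there (l.append_right Δ)

/-- A variable visible in a context lies to the right of every lock. -/
theorem Lookup.of_append_lock {Γ Δ : Ctx} {n : Nat} {A : Ty}
    (l : Lookup (Γ ++ Entry.lock :: Δ) n A) : n < vars Γ ∧ Nonempty (Lookup Γ n A) := by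
  induction Γ generalizing n with
  | nil => cases l
  | cons x Γ ih =>
    cases l with
    | here => exact ⟨Nat.succ_pos _, ⟨.here⟩⟩
    | there l => exact ⟨Nat.succ_lt_succ (ih l).1, (ih l).2.map .there⟩

/-- Lock replacement for IS4: if `Γ, 🔒, Γ'' ⊢ t : A` is
derivable then `Γ, Γ', Γ'' ⊢ t : A` is derivable, for any context `Γ'`
(in de Bruijn representation the term is renamed by lifting the indices at
the position of the replaced lock). -/
theorem lock_replacement {Γ Γ'' : Ctx} {t : Tm} {A : Ty}
    (d : Deriv (Γ'' ++ Entry.lock :: Γ) t A) (Γ' : Ctx) :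
    Nonempty (Deriv (Γ'' ++ Γ' ++ Γ) (t.lift (vars Γ') (vars Γ'')) A) := by
  generalize hΔ : Γ'' ++ Entry.lock :: Γ = Δ at d
  induction d generalizing Γ'' with
  | var h =>
    subst hΔ
    obtain ⟨hn, h'⟩ := h.of_append_lock
    rw [Tm.lift, if_pos hn, List.append_assoc]
    exact h'.map fun l => .var (l.append_right _)
  | @lam _ _ A _ _ ih => exact (ih (Γ'' := Entry.var A :: Γ'') (by simp [hΔ])).map .lam
  | app _ _ ih₁ ih₂ =>
    obtain ⟨d₁⟩ := ih₁ hΔ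
    obtain ⟨d₂⟩ := ih₂ hΔ
    exact ⟨.app d₁ d₂⟩
  | shut _ ih => exact (ih (Γ'' := Entry.lock :: Γ'') (by simp [hΔ])).map .shut
  | @opn Δ t A d Θ ih =>
    rcases List.append_eq_append_iff.mp hΔ with ⟨R, hΘ, hR⟩ | ⟨R, rfl, hR⟩
    · cases R with
      | nil =>
        obtain rfl : Θ = Γ'' := by simpa using hΘ
        obtain ⟨e⟩ := ih (Γ'' := []) (by simpa using hR)
        refine ⟨?_⟩
        have := Deriv.opn e Θ
        rw [← Nat.zero_add (vars []), ← Tm.lift_lift_comm] at this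
        simpa [Tm.lift, vars] using this
      | cons x R =>
        obtain ⟨rfl, rfl⟩ : x = Entry.lock ∧ Γ = R ++ Δ := by simpa [eq_comm] using hR
        subst hΘ
        refine ⟨?_⟩
        have hl := Tm.lift_lift_of_le t (a := vars (Γ'' ++ Entry.lock :: R)) (b := vars Γ')
          (c := 0) (k := vars Γ'') (by simp [vars_append])
        have hv : vars (Γ'' ++ Entry.lock :: R) + vars Γ' = vars (Γ'' ++ Γ' ++ R) := by
          simp only [vars_append, vars]; omega
        rw [Nat.zero_add] at hl
        rw [Tm.lift, hl, hv, ← List.append_assoc]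
        exact .opn d _
    · obtain ⟨e⟩ := ih hR.symm
      refine ⟨?_⟩
      have := Deriv.opn e Θ
      rw [← Nat.zero_add (vars R), ← Tm.lift_lift_comm] at this
      simpa [Tm.lift, vars_append] using this

end FitchIS4
end

section
/- Lock Weakening for the Fitch-style IR calculus: if Γ, Γ' ⊢ t : A is derivable then Γ, 🔒, Γ' ⊢ t : A is derivable. -/
namespace FitchIR

/-- Types of the Fitch-style calculus for IR (IK plus the axiom R : A → □A),
with the left adjoint `◇`. -/
inductive Ty : Type
  | base : Nat → Ty
  | unit : Ty
  | prod : Ty → Ty → Ty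
  | arr : Ty → Ty → Ty
  | box : Ty → Ty
  | dia : Ty → Ty

/-- A context entry is either a variable declaration or a lock 🔒. -/
inductive Entry : Type
  | var : Ty → Entry
  | lock : Entry

/-- Contexts: lists of entries, the head of the list being the rightmost entry. -/
abbrev Ctx := List Entry

/-- The number of variable entries of a context. -/
def vars : Ctx → Nat
  | [] => 0
  | Entry.var _ :: Γ => vars Γ + 1
  | Entry.lock :: Γ => vars Γ

/-- Terms, with de Bruijn indices counting variable entries. -/
inductive Tm : Type
  | var : Nat → Tm
  | lam : Tm → Tm
  | app : Tm → Tm → Tm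
  | star : Tm
  | pair : Tm → Tm → Tm
  | fst : Tm → Tm
  | snd : Tm → Tm
  | shut : Tm → Tm
  | opn : Tm → Tm
  | dia : Tm → Tm
  | letd : Tm → Tm → Tm

/-- `t.lift d c` adds `d` to the variables of index `≥ c` (weakening). -/
def Tm.lift (d : Nat) : Tm → Nat → Tm
  | .var n, c => if n < c then .var n else .var (n + d)
  | .lam t, c => .lam (t.lift d (c+1))
  | .app t u, c => .app (t.lift d c) (u.lift d c)
  | .star, _ => .star
  | .pair t u, c => .pair (t.lift d c) (u.lift d c)
  | .fst t, c => .fst (t.lift d c)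
  | .snd t, c => .snd (t.lift d c)
  | .shut t, c => .shut (t.lift d c)
  | .opn t, c => .opn (t.lift d c)
  | .dia t, c => .dia (t.lift d c)
  | .letd t u, c => .letd (t.lift d c) u

/-- Variable lookup for IR: since the side condition `🔒 ∉ Γ'` is dropped,
variables may be looked up across locks. -/
inductive Lookup : Ctx → Nat → Ty → Type
  | here {Γ A} : Lookup (Entry.var A :: Γ) 0 A
  | there {Γ n A B} : Lookup Γ n A → Lookup (Entry.var B :: Γ) (n+1) A
  | lock {Γ n A} : Lookup Γ n A → Lookup (Entry.lock :: Γ) n A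

/-- Typing derivations for the Fitch-style calculus for IR: the rules of the
IK◇ calculus with the side-conditions `🔒 ∉ Γ'` removed from the variable,
`open` and `dia` rules. -/
inductive Deriv : Ctx → Tm → Ty → Type
  | var {Γ n A} : Lookup Γ n A → Deriv Γ (.var n) A
  | lam {Γ t A B} : Deriv (Entry.var A :: Γ) t B → Deriv Γ (.lam t) (Ty.arr A B)
  | app {Γ t u A B} : Deriv Γ t (Ty.arr A B) → Deriv Γ u A → Deriv Γ (.app t u) B
  | star {Γ} : Deriv Γ .star Ty.unit
  | pair {Γ t u A B} : Deriv Γ t A → Deriv Γ u B → Deriv Γ (.pair t u) (Ty.prod A B)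
  | fst {Γ t A B} : Deriv Γ t (Ty.prod A B) → Deriv Γ (.fst t) A
  | snd {Γ t A B} : Deriv Γ t (Ty.prod A B) → Deriv Γ (.snd t) B
  | shut {Γ t A} : Deriv (Entry.lock :: Γ) t A → Deriv Γ (.shut t) (Ty.box A)
  | opn {Γ t A} : Deriv Γ t (Ty.box A) → (Γ' : Ctx) →
      Deriv (Γ' ++ Entry.lock :: Γ) (.opn (t.lift (vars Γ') 0)) A
  | dia {Γ t A} : Deriv Γ t A → (Γ' : Ctx) →
      Deriv (Γ' ++ Entry.lock :: Γ) (.dia (t.lift (vars Γ') 0)) (Ty.dia A)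
  | letd {Γ t u A B} : Deriv Γ t (Ty.dia A) →
      Deriv [Entry.lock, Entry.var A] u B → Deriv Γ (.letd t u) B

theorem vars_append (Γ' Γ : Ctx) : vars (Γ' ++ Γ) = vars Γ' + vars Γ := by
  induction Γ' with
  | nil => simp [vars]
  | cons e Γ' ih => cases e <;> grind [vars]

theorem Lookup.insert_lock {Γ : Ctx} {n : Nat} {A : Ty} :
    ∀ {Γ' : Ctx}, Lookup (Γ' ++ Γ) n A → Nonempty (Lookup (Γ' ++ Entry.lock :: Γ) n A) := by
  intro Γ' l
  induction Γ' generalizing n with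
  | nil => exact ⟨.lock l⟩
  | cons e Γ' ih =>
    cases l with
    | here => exact ⟨.here⟩
    | there l => exact (ih l).map .there
    | lock l => exact (ih l).map .lock

/-- Inserting a lock into a context that is split at a lock either enlarges the part to the right
of the split without adding variables, or inserts a lock into the part to the left. -/
theorem exists_split_insert_lock {Γ Γ' Δ Δ' : Ctx} (h : Δ' ++ Entry.lock :: Δ = Γ' ++ Γ) :
    ∃ Θ Θ' : Ctx, Γ' ++ Entry.lock :: Γ = Θ' ++ Entry.lock :: Θ ∧ vars Θ' = vars Δ' ∧
      (Θ = Δ ∨ ∃ Ξ : Ctx, Δ = Ξ ++ Γ ∧ Θ = Ξ ++ Entry.lock :: Γ) := by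
  rcases List.append_eq_append_iff.1 h with ⟨Ξ, rfl, hΞ⟩ | ⟨Ξ, rfl, rfl⟩
  · cases Ξ with
    | nil =>
      obtain rfl : Entry.lock :: Δ = Γ := hΞ
      exact ⟨Δ, Δ' ++ [Entry.lock], by simp, by simp [vars_append, vars], .inl rfl⟩
    | cons e Ξ =>
      obtain ⟨rfl, rfl⟩ := List.cons_eq_cons.1 hΞ
      exact ⟨Ξ ++ Entry.lock :: Γ, Δ', by simp, rfl, .inr ⟨Ξ, rfl, rfl⟩⟩
  · exact ⟨Δ, Γ' ++ Entry.lock :: Ξ, by simp, by simp [vars_append, vars], .inl rfl⟩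

/-- Lock weakening for IR: if `Γ, Γ' ⊢ t : A` is derivable
then `Γ, 🔒, Γ' ⊢ t : A` is derivable. -/
theorem lock_weakening {Γ Γ' : Ctx} {t : Tm} {A : Ty}
    (d : Deriv (Γ' ++ Γ) t A) :
    Nonempty (Deriv (Γ' ++ Entry.lock :: Γ) t A) := by
  generalize hΔ : Γ' ++ Γ = Δ at d
  replace hΔ := hΔ.symm
  induction d generalizing Γ Γ' with
  | var l =>
    subst hΔ
    exact l.insert_lock.map .var
  | lam _ ih =>
    subst hΔ
    exact (ih (Γ' := Entry.var _ :: Γ') rfl).map .lam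
  | app _ _ ih₁ ih₂ => exact (ih₁ hΔ).elim fun d₁ => (ih₂ hΔ).map d₁.app
  | star => exact ⟨.star⟩
  | pair _ _ ih₁ ih₂ => exact (ih₁ hΔ).elim fun d₁ => (ih₂ hΔ).map d₁.pair
  | fst _ ih => exact (ih hΔ).map .fst
  | snd _ ih => exact (ih hΔ).map .snd
  | shut _ ih =>
    subst hΔ
    exact (ih (Γ' := Entry.lock :: Γ') rfl).map .shut
  | opn d Δ' ih =>
    obtain ⟨Θ, Θ', e, hv, hΘ⟩ := exists_split_insert_lock hΔ
    rw [e, ← hv]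
    rcases hΘ with rfl | ⟨Ξ, rfl, rfl⟩
    · exact ⟨.opn d Θ'⟩
    · exact (ih rfl).map fun d => .opn d Θ'
  | dia d Δ' ih =>
    obtain ⟨Θ, Θ', e, hv, hΘ⟩ := exists_split_insert_lock hΔ
    rw [e, ← hv]
    rcases hΘ with rfl | ⟨Ξ, rfl, rfl⟩
    · exact ⟨.dia d Θ'⟩
    · exact (ih rfl).map fun d => .dia d Θ'
  | letd _ u ih _ => exact (ih hΔ).map (.letd · u)

end FitchIR
end
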